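/- Let A be the weighted adjacency matrix of an undirected weighted graph with loops whose row sums are all positive, D the diagonal matrix of row sums, and T = D^{-1} A the transition matrix. Let S₁, …, S_p be pairwise disjoint subsets of vertices, with |S_t| = m_t ≥ 2, such that each S_t carries an (m_t,k_t,s_t)-star with loops, with loop weight ℓ_t, central weight a_t and weight w_t, and suppose (ℓ_t − a_t)/w_t = λ for all t. Then λ is an eigenvalue of T and the eigenspace ker(T − λ·I) has dimension at least Σ_{t=1}^{p} (m_t − 1). -/

import Mathlib

open Matrix in
/-- If `i` and `j` are distinct vertices with the same loop weight whose rows agree off `{i, j}`,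
then `eᵢ - eⱼ` is an eigenvector of the transition matrix. -/
theorem diagonal_mul_mulVec_single_sub_single {ι : Type*} [Fintype ι] [DecidableEq ι]
    {A : Matrix ι ι ℝ} (hA : A.IsSymm) {d : ι → ℝ} {i j : ι} (hij : i ≠ j)
    (hloop : A i i = A j j) (hd : d i = d j) (hout : ∀ k, k ≠ i → k ≠ j → A i k = A j k) :
    (diagonal d * A) *ᵥ (Pi.single i 1 - Pi.single j 1) =
      (d i * (A i i - A i j)) • (Pi.single i 1 - Pi.single j 1 : ι → ℝ) := by
  ext k
  rw [mulVec_sub, mulVec_single_one, mulVec_single_one]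
  simp only [Pi.sub_apply, col_apply, diagonal_mul, Pi.smul_apply, smul_eq_mul]
  by_cases hki : k = i
  · subst hki
    simp [hij]
    ring
  by_cases hkj : k = j
  · subst hkj
    simp [hki, hA.apply i k, hloop, hd]
    ring
  · simp [hki, hkj, ← hA.apply k i, ← hA.apply k j, hout k hki hkj]

/-- For pairwise disjoint finsets `S t` with base points `c t ∈ S t`, the vectors `eᵢ - e_{c t}`
with `i ∈ S t`, `i ≠ c t`, are linearly independent. -/
theorem linearIndependent_single_sub_single {ι τ : Type*} [DecidableEq ι] [Fintype τ]
    {S : τ → Finset ι} (hS : ∀ t t', t ≠ t' → Disjoint (S t) (S t'))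
    {c : τ → ι} (hc : ∀ t, c t ∈ S t) :
    LinearIndependent ℝ (fun x : Σ t, {i // i ∈ (S t).erase (c t)} =>
      (Pi.single x.2.1 1 - Pi.single (c x.1) 1 : ι → ℝ)) := by
  have eq_of_mem : ∀ {t t' i}, i ∈ S t → i ∈ S t' → t = t' := fun {t t' i} h h' => by
    by_contra hne
    exact Finset.disjoint_left.mp (hS t t' hne) h h'
  rw [Fintype.linearIndependent_iff]
  rintro g hg ⟨s, j, hj⟩
  have hjS := Finset.mem_erase.mp hj
  have hjc : ∀ t, j ≠ c t := by
    rintro t rfl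
    obtain rfl := eq_of_mem hjS.2 (hc t)
    exact hjS.1 rfl
  have h := congrFun hg j
  rw [Finset.sum_apply, Finset.sum_eq_single ⟨s, j, hj⟩] at h
  · simpa [hjc] using h
  · rintro ⟨t, i, hi⟩ - hne
    have hji : j ≠ i := by
      rintro rfl
      obtain rfl := eq_of_mem hjS.2 (Finset.mem_erase.mp hi).2
      exact hne rfl
    simp [hjc, hji]
  · simp

/-- In a weighted graph possibly with loops, with all row sums positive, if
pairwise disjoint subsets `S t` (of sizes `m t ≥ 2`) carry `(m_t,k_t,s_t)`-stars with loops,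
with loop weights `ℓ t`, central weights `a t` and weights `w t` such that
`(ℓ t - a t) / w t = lam` for all `t`, then `lam` is an eigenvalue of the transition matrix
`T = D⁻¹ A` with eigenspace of dimension at least `∑ (m t - 1)`. -/
theorem stmt_9 {n p : ℕ} (hp : 0 < p) (A : Matrix (Fin n) (Fin n) ℝ)
    (hsymm : A.IsSymm)
    (hnonneg : ∀ i j, 0 ≤ A i j)
    (hpos : ∀ i, 0 < ∑ j, A i j)
    (T : Matrix (Fin n) (Fin n) ℝ)
    (hT : T = Matrix.diagonal (fun i => (∑ j, A i j)⁻¹) * A)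
    (S : Fin p → Finset (Fin n)) (m : Fin p → ℕ)
    (hm : ∀ t, 2 ≤ m t) (hcard : ∀ t, (S t).card = m t)
    (hdisj : ∀ t t', t ≠ t' → Disjoint (S t) (S t'))
    (ℓ a w : Fin p → ℝ) (hℓ : ∀ t, 0 ≤ ℓ t) (ha : ∀ t, 0 ≤ a t)
    (hloop : ∀ t, ∀ i ∈ S t, A i i = ℓ t)
    (hstar_center : ∀ t, ∀ i ∈ S t, ∀ j ∈ S t, i ≠ j → A i j = a t)
    (hstar_out : ∀ t, ∀ i ∈ S t, ∀ j ∈ S t, ∀ l, l ∉ S t → A i l = A j l)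
    (hw : ∀ t, ∀ i ∈ S t, ∑ l, A i l = w t)
    (lam : ℝ) (hlam : ∀ t, (ℓ t - a t) / w t = lam) :
    Module.End.HasEigenvalue (Matrix.toLin' T) lam ∧
    (∑ t, (m t - 1)) ≤
      Module.finrank ℝ (Module.End.eigenspace (Matrix.toLin' T) lam) := by
  have hne : ∀ t, (S t).Nonempty := fun t => by
    rw [← Finset.card_pos, hcard t]
    have := hm t
    omega
  choose c hc using hne
  have hmem : ∀ x : Σ t, {i // i ∈ (S t).erase (c t)},
      (Pi.single x.2.1 1 - Pi.single (c x.1) 1 : Fin n → ℝ) ∈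
        Module.End.eigenspace (Matrix.toLin' T) lam := by
    rintro ⟨t, i, hi⟩
    obtain ⟨hic, hiS⟩ := Finset.mem_erase.mp hi
    rw [Module.End.mem_eigenspace_iff, Matrix.toLin'_apply, hT,
      diagonal_mul_mulVec_single_sub_single hsymm hic]
    · rw [hw t i hiS, hloop t i hiS, hstar_center t i hiS _ (hc t) hic, ← hlam t, inv_mul_eq_div]
    · rw [hloop t i hiS, hloop t _ (hc t)]
    · rw [hw t i hiS, hw t _ (hc t)]
    · intro k hki hkc
      by_cases hk : k ∈ S t
      · rw [hstar_center t i hiS k hk hki.symm, hstar_center t _ (hc t) k hk hkc.symm]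
      · exact hstar_out t i hiS _ (hc t) k hk
  have hdim : (∑ t, (m t - 1)) ≤
      Module.finrank ℝ (Module.End.eigenspace (Matrix.toLin' T) lam) := by
    have hcard_index : Fintype.card (Σ t, {i // i ∈ (S t).erase (c t)}) = ∑ t, (m t - 1) := by
      simp only [Fintype.card_sigma, Fintype.card_coe]
      exact Finset.sum_congr rfl fun t _ => by rw [Finset.card_erase_of_mem (hc t), hcard t]
    rw [← hcard_index, ← finrank_span_eq_card (linearIndependent_single_sub_single hdisj hc)]
    apply Submodule.finrank_mono
    rw [Submodule.span_le]
    rintro _ ⟨x, rfl⟩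
    exact hmem x
  refine ⟨fun hbot => ?_, hdim⟩
  have hle : m ⟨0, hp⟩ - 1 ≤ ∑ t, (m t - 1) :=
    Finset.single_le_sum (f := fun t => m t - 1) (fun _ _ => Nat.zero_le _) (Finset.mem_univ _)
  have hm₀ := hm ⟨0, hp⟩
  have hzero : Module.finrank ℝ (Module.End.eigenspace (Matrix.toLin' T) lam) = 0 :=
    Submodule.finrank_eq_zero.mpr hbot
  omega
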